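/- arXiv:math/0411257 — 2 statements merged into one kernel-verified Lean document; each statement's English description precedes it below -/
import Mathlib

section
/- Let μ ≠ 0 be a nilpotent Lie bracket on ℝⁿ. Then the following are equivalent: (a) for every g ∈ GL(n,ℝ), tr(Ric_{g·μ}²)/‖g·μ‖⁴ ≥ tr(Ric_μ²)/‖μ‖⁴; (b) Ric_μ = cI + D for some c ∈ ℝ and some derivation D ∈ Der(μ). -/
open scoped BigOperators Matrix

abbrev Vm (m : ℕ) := (Fin m → ℝ) → (Fin m → ℝ) → (Fin m → ℝ)

def IsSkewBilin {m : ℕ} (μ : Vm m) : Prop :=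
  (∀ (c : ℝ) (X X' Y : Fin m → ℝ), μ (c • X + X') Y = c • μ X Y + μ X' Y) ∧
  (∀ (c : ℝ) (X Y Y' : Fin m → ℝ), μ X (c • Y + Y') = c • μ X Y + μ X Y') ∧
  (∀ X Y, μ X Y = - μ Y X)

/-- The Jacobi identity. -/
def Jacobi {m : ℕ} (μ : Vm m) : Prop :=
  ∀ X Y Z, μ (μ X Y) Z + μ (μ Y Z) X + μ (μ Z X) Y = 0

/-- Left-normed iterated bracket `μ(X_k, μ(X_{k-1}, ⋯ μ(X_1, X_0)⋯))`. -/
def iterBrk {m : ℕ} (μ : Vm m) (X : ℕ → (Fin m → ℝ)) : ℕ → (Fin m → ℝ)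
  | 0 => X 0
  | (k+1) => μ (X (k+1)) (iterBrk μ X k)

/-- `(ℝᵐ, μ)` is a nilpotent Lie algebra: some term of the lower central series vanishes,
equivalently all left-normed brackets of some fixed length vanish. -/
def IsNilp {m : ℕ} (μ : Vm m) : Prop :=
  ∃ k : ℕ, ∀ X : ℕ → (Fin m → ℝ), iterBrk μ X k = 0

noncomputable def stdb (m : ℕ) (i : Fin m) : Fin m → ℝ := Pi.single i 1

noncomputable def Ric {m : ℕ} (μ : Vm m) : Matrix (Fin m) (Fin m) ℝ :=
  Matrix.of fun x y =>
    -(1/2) * (∑ i, ∑ j, μ (stdb m x) (stdb m i) j * μ (stdb m y) (stdb m i) j)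
      + (1/4) * (∑ i, ∑ j, μ (stdb m i) (stdb m j) x * μ (stdb m i) (stdb m j) y)

noncomputable def normSq {m : ℕ} (μ : Vm m) : ℝ :=
  ∑ i, ∑ j, ∑ k, (μ (stdb m i) (stdb m j) k) ^ 2

/-- `D` is a derivation of the bracket `μ`. -/
def IsDeriv {m : ℕ} (μ : Vm m) (D : Matrix (Fin m) (Fin m) ℝ) : Prop :=
  ∀ X Y, D.mulVec (μ X Y) = μ (D.mulVec X) Y + μ X (D.mulVec Y)

/-- The action `(g·μ)(X,Y) = g μ(g⁻¹X, g⁻¹Y)` of `GL(n,ℝ)` on brackets. -/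
noncomputable def act {m : ℕ} (g : GL (Fin m) ℝ) (μ : Vm m) : Vm m :=
  fun X Y =>
    (g : Matrix (Fin m) (Fin m) ℝ).mulVec
      (μ (((g⁻¹ : GL (Fin m) ℝ) : Matrix (Fin m) (Fin m) ℝ).mulVec X)
         (((g⁻¹ : GL (Fin m) ℝ) : Matrix (Fin m) (Fin m) ℝ).mulVec Y))


namespace Bracket

variable {n : ℕ}

/-- The structure constants of `μ` in the standard basis. -/
noncomputable def structConst (μ : Vm n) (i j k : Fin n) : ℝ := μ (stdb n i) (stdb n j) k

theorem sum_smul_stdb (X : Fin n → ℝ) : ∑ i, X i • stdb n i = X := by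
  ext k
  simp [stdb, Finset.sum_apply, Pi.single_apply]

theorem apply_eq_sum_structConst {μ : Vm n} (h : IsSkewBilin μ) (X Y : Fin n → ℝ) (k : Fin n) :
    μ X Y k = ∑ i, ∑ j, X i * Y j * structConst μ i j k := by
  obtain ⟨h1, h2, -⟩ := h
  let f : (Fin n → ℝ) →ₗ[ℝ] (Fin n → ℝ) →ₗ[ℝ] (Fin n → ℝ) :=
    LinearMap.mk₂ ℝ μ
      (fun X X' Y => by simpa using h1 1 X X' Y)
      (fun c X Y => by
        have h0 : μ 0 Y = 0 := by simpa using h1 1 0 0 Y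
        simpa [h0] using h1 c X 0 Y)
      (fun X Y Y' => by simpa using h2 1 X Y Y')
      (fun c X Y => by
        have h0 : μ X 0 = 0 := by simpa using h2 1 X 0 0
        simpa [h0] using h2 c X Y 0)
  have key : f X Y = ∑ i, ∑ j, (X i * Y j) • f (stdb n i) (stdb n j) := by
    conv_lhs => rw [← sum_smul_stdb X, ← sum_smul_stdb Y]
    simp only [map_sum, map_smul, LinearMap.sum_apply, LinearMap.smul_apply, Finset.smul_sum,
      smul_smul]
    rw [Finset.sum_comm]
    simp only [mul_comm]
  have := congrFun key k
  simpa [f, Finset.sum_apply, structConst] using this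

theorem structConst_skew {μ : Vm n} (h : IsSkewBilin μ) (i j k : Fin n) :
    structConst μ i j k = - structConst μ j i k := by
  simp only [structConst]
  rw [h.2.2]
  rfl

theorem isSkewBilin_act {μ : Vm n} (h : IsSkewBilin μ) (g : GL (Fin n) ℝ) :
    IsSkewBilin (act g μ) := by
  obtain ⟨h1, h2, h3⟩ := h
  refine ⟨fun c X X' Y => ?_, fun c X Y Y' => ?_, fun X Y => ?_⟩
  · simp only [act, Matrix.mulVec_add, Matrix.mulVec_smul, h1]
  · simp only [act, Matrix.mulVec_add, Matrix.mulVec_smul, h2]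
  · simp only [act]
    rw [h3, Matrix.mulVec_neg]

theorem act_mul (g h : GL (Fin n) ℝ) (μ : Vm n) : act (g * h) μ = act g (act h μ) := by
  funext X Y
  simp [act, Matrix.mulVec_mulVec, mul_inv_rev]

theorem act_one (μ : Vm n) : act 1 μ = μ := by
  funext X Y
  simp [act]

theorem act_ne_zero {μ : Vm n} (hne : μ ≠ 0) (g : GL (Fin n) ℝ) : act g μ ≠ 0 := by
  intro h0
  apply hne
  rw [← act_one μ, ← inv_mul_cancel g, act_mul, h0]
  funext X Y
  simp [act]

theorem structConst_act {μ : Vm n} (h : IsSkewBilin μ) (g : GL (Fin n) ℝ) (i j k : Fin n) :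
    structConst (act g μ) i j k =
      ∑ c, g.1 k c * ∑ a, ∑ b, g⁻¹.1 a i * g⁻¹.1 b j * structConst μ a b c := by
  simp only [structConst, act, Matrix.mulVec, dotProduct]
  refine Finset.sum_congr rfl fun c _ => ?_
  rw [apply_eq_sum_structConst h]
  simp [stdb, structConst, Matrix.mulVec, dotProduct, Pi.single_apply]

/-- The bracket is determined by its structure constants, so a nonzero one has positive norm. -/
theorem normSq_pos {μ : Vm n} (h : IsSkewBilin μ) (hne : μ ≠ 0) : 0 < normSq μ := by
  have h0 : 0 ≤ normSq μ := by unfold normSq; positivity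
  refine h0.lt_of_ne fun h1 => hne ?_
  have hs : ∀ i j k, structConst μ i j k = 0 := by
    intro i j k
    have e1 := (Finset.sum_eq_zero_iff_of_nonneg (fun i _ => by positivity)).1 h1.symm i
      (Finset.mem_univ i)
    have e2 := (Finset.sum_eq_zero_iff_of_nonneg (fun i _ => by positivity)).1 e1 j
      (Finset.mem_univ j)
    have e3 := (Finset.sum_eq_zero_iff_of_nonneg (fun i _ => by positivity)).1 e2 k
      (Finset.mem_univ k)
    exact pow_eq_zero_iff two_ne_zero |>.1 e3
  funext X Y k
  rw [apply_eq_sum_structConst h]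
  simp [hs]

/-- The Gram matrix of a family of matrices for the Frobenius inner product. -/
noncomputable def gram (A : Fin n → Matrix (Fin n) (Fin n) ℝ) : Matrix (Fin n) (Fin n) ℝ :=
  Matrix.of fun x y => (A x * (A y)ᵀ).trace

theorem gram_conj (A : Fin n → Matrix (Fin n) (Fin n) ℝ) {k : Matrix (Fin n) (Fin n) ℝ}
    (hk : kᵀ * k = 1) :
    gram (fun x => ∑ l, k x l • (k * A l * kᵀ)) = k * gram A * kᵀ := by
  have h2 : ∀ l m, ((k * A l * kᵀ) * (k * A m * kᵀ)ᵀ).trace = (A l * (A m)ᵀ).trace := by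
    intro l m
    have : (k * A l * kᵀ) * (k * A m * kᵀ)ᵀ = k * (A l * (kᵀ * k) * (A m)ᵀ * kᵀ) := by
      simp only [Matrix.transpose_mul, Matrix.transpose_transpose, Matrix.mul_assoc]
    rw [this, Matrix.trace_mul_comm, hk, Matrix.mul_assoc, hk]
    simp
  ext x y
  simp only [gram, Matrix.of_apply, Matrix.transpose_sum, Matrix.transpose_smul,
    Matrix.mul_sum, Matrix.smul_mul, Matrix.mul_smul, Matrix.trace_sum, Matrix.trace_smul, h2,
    Matrix.mul_apply, Matrix.transpose_apply, smul_eq_mul, Finset.sum_mul]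
  rw [Finset.sum_comm]
  refine Finset.sum_congr rfl fun i _ => Finset.sum_congr rfl fun j _ => ?_
  ring

theorem Ric_eq_gram (μ : Vm n) :
    Ric μ = (-(1/2) : ℝ) • gram (fun x => Matrix.of fun i j => structConst μ x i j) +
      (1/4 : ℝ) • gram (fun x => Matrix.of fun i j => structConst μ i j x) := by
  ext x y
  simp [Ric, gram, structConst, Matrix.trace, Matrix.mul_apply]

theorem Ric_isSymm (μ : Vm n) : (Ric μ)ᵀ = Ric μ := by
  ext x y
  simp only [Ric, Matrix.transpose_apply, Matrix.of_apply, mul_comm]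

theorem Ric_act_of_orthogonal {μ : Vm n} (h : IsSkewBilin μ) {k : GL (Fin n) ℝ}
    (hk : k⁻¹.1 = k.1ᵀ) : Ric (act k μ) = k.1 * Ric μ * k.1ᵀ := by
  have hk' : k.1ᵀ * k.1 = 1 := by rw [← hk]; exact k.inv_mul
  have e1 : (fun x => Matrix.of fun i j => structConst (act k μ) x i j) =
      fun x => ∑ l, k.1 x l • (k.1 * (Matrix.of fun i j => structConst μ l i j) * k.1ᵀ) := by
    funext x
    ext i j
    simp only [Matrix.of_apply, structConst_act h, hk, Matrix.transpose_apply, Matrix.sum_apply,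
      Matrix.smul_apply, Matrix.mul_apply, smul_eq_mul, Finset.mul_sum, Finset.sum_mul]
    rw [Finset.sum_comm]
    refine Finset.sum_congr rfl fun a _ => Finset.sum_congr rfl fun b _ =>
      Finset.sum_congr rfl fun c _ => ?_
    ring
  have e2 : (fun x => Matrix.of fun i j => structConst (act k μ) i j x) =
      fun x => ∑ l, k.1 x l • (k.1 * (Matrix.of fun i j => structConst μ i j l) * k.1ᵀ) := by
    funext x
    ext i j
    simp only [Matrix.of_apply, structConst_act h, hk, Matrix.transpose_apply, Matrix.sum_apply,
      Matrix.smul_apply, Matrix.mul_apply, smul_eq_mul, Finset.mul_sum, Finset.sum_mul]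
    refine Finset.sum_congr rfl fun a _ => ?_
    rw [Finset.sum_comm]
    refine Finset.sum_congr rfl fun b _ => Finset.sum_congr rfl fun c _ => ?_
    ring
  rw [Ric_eq_gram, Ric_eq_gram, e1, e2, gram_conj _ hk', gram_conj _ hk']
  simp [Matrix.mul_add, Matrix.add_mul]

/-- The moment map identity `tr (Ric_μ E) = ¼ ⟨π(E) μ, μ⟩` for diagonal `E`. -/
theorem sum_mul_Ric_diag {μ : Vm n} (h : IsSkewBilin μ) (d : Fin n → ℝ) :
    ∑ x, d x * Ric μ x x =
      1/4 * ∑ i, ∑ j, ∑ k, (d k - d i - d j) * structConst μ i j k ^ 2 := by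
  have hR : ∀ x, Ric μ x x = -(1/2) * (∑ i, ∑ j, structConst μ x i j ^ 2) +
      1/4 * ∑ i, ∑ j, structConst μ i j x ^ 2 := by
    intro x
    simp only [Ric, Matrix.of_apply, structConst, sq]
  have h1 : ∑ i, ∑ j, ∑ k, d j * structConst μ i j k ^ 2 =
      ∑ i, ∑ j, ∑ k, d i * structConst μ i j k ^ 2 := by
    rw [Finset.sum_comm]
    refine Finset.sum_congr rfl fun i _ => Finset.sum_congr rfl fun j _ =>
      Finset.sum_congr rfl fun k _ => ?_
    rw [structConst_skew h j i k]
    ring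
  have h2 : ∑ i, ∑ j, ∑ k, d k * structConst μ i j k ^ 2 =
      ∑ k, ∑ i, ∑ j, d k * structConst μ i j k ^ 2 := by
    conv_rhs => rw [Finset.sum_comm]
    exact Finset.sum_congr rfl fun i _ => Finset.sum_comm
  have h3 : ∑ i, ∑ j, ∑ k, (d k - d i - d j) * structConst μ i j k ^ 2 =
      ∑ k, ∑ i, ∑ j, d k * structConst μ i j k ^ 2 -
        2 * ∑ i, ∑ j, ∑ k, d i * structConst μ i j k ^ 2 := by
    simp only [sub_mul, Finset.sum_sub_distrib]
    rw [h1, h2]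
    ring
  rw [h3]
  simp only [hR, mul_add, Finset.sum_add_distrib, mul_left_comm (d _), ← Finset.mul_sum]
  ring

theorem normSq_eq_neg_four_mul_trace_Ric {μ : Vm n} (h : IsSkewBilin μ) :
    normSq μ = -4 * (Ric μ).trace := by
  have := sum_mul_Ric_diag h (fun _ => 1)
  simp only [one_mul] at this
  simp only [Matrix.trace, Matrix.diag_apply, this, normSq, structConst, Finset.mul_sum]
  simp only [← mul_assoc]
  norm_num

/-- The scale-invariant functional `tr (Ric²) / ‖·‖⁴`. -/
noncomputable def ricFunctional (μ : Vm n) : ℝ := (Ric μ * Ric μ).trace / normSq μ ^ 2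

theorem ricFunctional_act_of_orthogonal {μ : Vm n} (h : IsSkewBilin μ) {k : GL (Fin n) ℝ}
    (hk : k⁻¹.1 = k.1ᵀ) : ricFunctional (act k μ) = ricFunctional μ := by
  have hk' : k.1ᵀ * k.1 = 1 := by rw [← hk]; exact k.inv_mul
  have e1 : (k.1 * Ric μ * k.1ᵀ * (k.1 * Ric μ * k.1ᵀ)).trace = (Ric μ * Ric μ).trace := by
    have : k.1 * Ric μ * k.1ᵀ * (k.1 * Ric μ * k.1ᵀ) =
        k.1 * (Ric μ * (k.1ᵀ * k.1) * Ric μ * k.1ᵀ) := by simp only [Matrix.mul_assoc]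
    rw [this, Matrix.trace_mul_comm, hk', Matrix.mul_assoc, hk']
    simp
  have e2 : (k.1 * Ric μ * k.1ᵀ).trace = (Ric μ).trace := by
    rw [Matrix.mul_assoc, Matrix.trace_mul_comm, Matrix.mul_assoc, hk', Matrix.mul_one]
  rw [ricFunctional, ricFunctional, normSq_eq_neg_four_mul_trace_Ric h,
    normSq_eq_neg_four_mul_trace_Ric (isSkewBilin_act h k), Ric_act_of_orthogonal h hk, e1, e2]

/-- A diagonal matrix is a derivation iff the structure constants vanish off its weights. -/
theorem isDeriv_diagonal_iff {μ : Vm n} (h : IsSkewBilin μ) (d : Fin n → ℝ) :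
    IsDeriv μ (Matrix.diagonal d) ↔ ∀ i j k, (d k - d i - d j) * structConst μ i j k = 0 := by
  constructor
  · intro hD i j k
    have := congrFun (hD (stdb n i) (stdb n j)) k
    rw [Pi.add_apply, Matrix.mulVec_diagonal, apply_eq_sum_structConst h (Matrix.mulVec _ _),
      apply_eq_sum_structConst h _ (Matrix.mulVec _ _)] at this
    simp [Matrix.mulVec_diagonal, stdb, Pi.single_apply] at this
    change d k * structConst μ i j k = _ at this
    linear_combination this
  · intro hs X Y
    funext k
    rw [Pi.add_apply, Matrix.mulVec_diagonal, apply_eq_sum_structConst h,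
      apply_eq_sum_structConst h (Matrix.mulVec _ _),
      apply_eq_sum_structConst h _ (Matrix.mulVec _ _), ← Finset.sum_add_distrib, Finset.mul_sum]
    refine Finset.sum_congr rfl fun i _ => ?_
    rw [← Finset.sum_add_distrib, Finset.mul_sum]
    refine Finset.sum_congr rfl fun j _ => ?_
    simp only [Matrix.mulVec_diagonal]
    linear_combination (X i * Y j) * hs i j k

theorem isDeriv_act {μ : Vm n} {D : Matrix (Fin n) (Fin n) ℝ} (hD : IsDeriv μ D)
    (g : GL (Fin n) ℝ) : IsDeriv (act g μ) (g.1 * D * g⁻¹.1) := by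
  have hg : g⁻¹.1 * g.1 = 1 := g.inv_mul
  intro X Y
  have e : ∀ X, g⁻¹.1.mulVec ((g.1 * D * g⁻¹.1).mulVec X) = D.mulVec (g⁻¹.1.mulVec X) := by
    intro X
    rw [Matrix.mulVec_mulVec, Matrix.mulVec_mulVec, ← Matrix.mul_assoc, ← Matrix.mul_assoc, hg,
      Matrix.one_mul]
  simp only [act, e]
  rw [← Matrix.mulVec_add, ← hD, Matrix.mulVec_mulVec, Matrix.mulVec_mulVec, Matrix.mul_assoc, hg,
    Matrix.mul_one]

/-- A matrix with orthonormal columns gives an element of `GL` whose inverse is its transpose. -/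
theorem exists_GL_of_transpose_mul_self {V : Matrix (Fin n) (Fin n) ℝ} (hV : Vᵀ * V = 1) :
    ∃ U : GL (Fin n) ℝ, U.1 = V ∧ U⁻¹.1 = U.1ᵀ :=
  ⟨⟨V, Vᵀ, mul_eq_one_comm.1 hV, hV⟩, rfl, rfl⟩

theorem inv_orthogonal {k : GL (Fin n) ℝ} (hk : k⁻¹.1 = k.1ᵀ) : k⁻¹⁻¹.1 = k⁻¹.1ᵀ := by
  rw [hk, inv_inv, Matrix.transpose_transpose]

/-- Orthogonal diagonalization with the eigenvalues in decreasing order. -/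
theorem exists_orthogonal_diagonalization {A : Matrix (Fin n) (Fin n) ℝ} (hA : Aᵀ = A) :
    ∃ (U : GL (Fin n) ℝ) (d : Fin n → ℝ), U⁻¹.1 = U.1ᵀ ∧ Antitone d ∧
      A = U.1 * Matrix.diagonal d * U⁻¹.1 := by
  have hH : A.IsHermitian := by
    rw [Matrix.IsHermitian, Matrix.conjTranspose_eq_transpose_of_trivial, hA]
  let V : Matrix (Fin n) (Fin n) ℝ := hH.eigenvectorUnitary
  have hV : Vᵀ * V = 1 := by
    have := Unitary.coe_star_mul_self hH.eigenvectorUnitary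
    rwa [Matrix.star_eq_conjTranspose, Matrix.conjTranspose_eq_transpose_of_trivial] at this
  have hspec : A = V * Matrix.diagonal hH.eigenvalues * Vᵀ := by
    have := hH.spectral_theorem
    rw [Unitary.conjStarAlgAut_apply, Matrix.star_eq_conjTranspose,
      Matrix.conjTranspose_eq_transpose_of_trivial] at this
    exact this
  let σ : Equiv.Perm (Fin n) := Tuple.sort (fun i => - hH.eigenvalues i)
  have hσ : (V.submatrix id σ)ᵀ * V.submatrix id σ = 1 := by
    rw [Matrix.transpose_submatrix, ← Matrix.submatrix_mul _ _ σ id σ Function.bijective_id, hV,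
      Matrix.submatrix_one_equiv]
  obtain ⟨U, hU, hUinv⟩ := exists_GL_of_transpose_mul_self hσ
  refine ⟨U, hH.eigenvalues ∘ σ, hUinv, fun i j hij => ?_, ?_⟩
  · have := Tuple.monotone_sort (fun i => - hH.eigenvalues i) hij
    simpa using this
  · rw [hUinv, hU, Matrix.transpose_submatrix, ← Matrix.submatrix_diagonal_equiv,
      Matrix.submatrix_mul_equiv, Matrix.submatrix_mul_equiv, ← hspec]
    rfl

/-- QR decomposition: an orthogonal matrix times an upper triangular one. -/
theorem exists_orthogonal_mul_upperTriangular (g : GL (Fin n) ℝ) :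
    ∃ Q R : GL (Fin n) ℝ, Q⁻¹.1 = Q.1ᵀ ∧ g = Q * R ∧
      (∀ i j, j < i → R.1 i j = 0) ∧ (∀ i j, j < i → R⁻¹.1 i j = 0) := by
  let f : Fin n → EuclideanSpace ℝ (Fin n) := fun j => WithLp.toLp 2 fun i => g.1 i j
  let b := InnerProductSpace.gramSchmidtOrthonormalBasis (𝕜 := ℝ) (E := EuclideanSpace ℝ (Fin n))
    (finrank_euclideanSpace (𝕜 := ℝ) (ι := Fin n)) f
  have hb : (Matrix.of fun i j => b j i)ᵀ * (Matrix.of fun i j => b j i) = 1 := by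
    ext i j
    have := orthonormal_iff_ite.1 b.orthonormal i j
    simp only [PiLp.inner_apply, RCLike.inner_apply, conj_trivial] at this
    simp only [Matrix.mul_apply, Matrix.transpose_apply, Matrix.of_apply, Matrix.one_apply]
    rw [← this]
    exact Finset.sum_congr rfl fun k _ => mul_comm _ _
  obtain ⟨Q, hQ, hQinv⟩ := exists_GL_of_transpose_mul_self hb
  have hR : (Q⁻¹ * g).1.IsUpperTriangular := by
    intro i j hij
    have := InnerProductSpace.gramSchmidtOrthonormalBasis_inv_triangular
      (finrank_euclideanSpace (𝕜 := ℝ) (ι := Fin n)) f (show j < i from hij)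
    simp only [PiLp.inner_apply, RCLike.inner_apply, conj_trivial] at this
    rw [Units.val_mul, hQinv, hQ, Matrix.mul_apply, ← this]
    exact Finset.sum_congr rfl fun k _ => mul_comm _ _
  refine ⟨Q, Q⁻¹ * g, hQinv, by simp, fun i j hij => hR hij, fun i j hij => ?_⟩
  let _ := (Q⁻¹ * g).invertible
  have := Matrix.blockTriangular_inv_of_blockTriangular hR
  rw [Matrix.coe_units_inv]
  exact this hij

/-- If `diag d` is a derivation of `μ` with `d` decreasing, then upper triangular matrices move `μ`
within the nonnegative weight spaces of `diag d`. -/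
theorem weight_nonneg_of_upperTriangular {μ : Vm n} (h : IsSkewBilin μ) {d : Fin n → ℝ}
    (hd : Antitone d) (hs : ∀ i j k, (d k - d i - d j) * structConst μ i j k = 0)
    {R : GL (Fin n) ℝ} (hR : ∀ i j, j < i → R.1 i j = 0) (hR' : ∀ i j, j < i → R⁻¹.1 i j = 0)
    (i j k : Fin n) : 0 ≤ (d k - d i - d j) * structConst (act R μ) i j k ^ 2 := by
  by_cases hw : 0 ≤ d k - d i - d j
  · positivity
  rw [not_le] at hw
  suffices structConst (act R μ) i j k = 0 by simp [this]
  rw [structConst_act h, Finset.sum_eq_zero fun c _ => ?_]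
  by_cases hc : c < k
  · rw [hR _ _ hc, zero_mul]
  rw [Finset.sum_eq_zero fun a _ => Finset.sum_eq_zero fun b _ => ?_, mul_zero]
  by_cases ha : i < a
  · rw [hR' _ _ ha]; ring
  by_cases hb : j < b
  · rw [hR' _ _ hb]; ring
  have h1 := hd (not_lt.1 hc)
  have h2 := hd (not_lt.1 ha)
  have h3 := hd (not_lt.1 hb)
  rcases mul_eq_zero.1 (hs a b c) with h0 | h0
  · linarith
  · rw [h0, mul_zero]

theorem sq_sum_mul_diag_le (r : Fin n → ℝ) (A : Matrix (Fin n) (Fin n) ℝ) (hA : Aᵀ = A) :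
    (∑ x, r x * A x x) ^ 2 ≤ (∑ x, r x ^ 2) * (A * A).trace := by
  refine (Finset.sum_mul_sq_le_sq_mul_sq _ _ _).trans
    (mul_le_mul_of_nonneg_left ?_ (Finset.sum_nonneg fun _ _ => sq_nonneg _))
  simp only [Matrix.trace, Matrix.diag_apply, Matrix.mul_apply]
  refine Finset.sum_le_sum fun x _ => ?_
  have : ∀ y, A x y * A y x = A x y ^ 2 := fun y => by
    rw [sq, ← congrFun (congrFun hA x) y, Matrix.transpose_apply]
  simp only [this]
  exact Finset.single_le_sum (f := fun y => A x y ^ 2) (fun y _ => sq_nonneg _) (Finset.mem_univ x)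

theorem trace_sq_of_diagonal {A : Matrix (Fin n) (Fin n) ℝ} {r : Fin n → ℝ}
    (hA : A = Matrix.diagonal r) : (A * A).trace = ∑ x, r x ^ 2 := by
  rw [hA, Matrix.diagonal_mul_diagonal, Matrix.trace_diagonal]
  exact Finset.sum_congr rfl fun x _ => (sq _).symm

theorem ricFunctional_le_of_diagonal {μ : Vm n} (h : IsSkewBilin μ) (hne : μ ≠ 0) {c : ℝ}
    {d : Fin n → ℝ} (hd : Antitone d) (hric : Ric μ = Matrix.diagonal fun i => c + d i)
    (hs : ∀ i j k, (d k - d i - d j) * structConst μ i j k = 0) (g : GL (Fin n) ℝ) :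
    ricFunctional μ ≤ ricFunctional (act g μ) := by
  obtain ⟨Q, R, hQ, rfl, hR, hR'⟩ := exists_orthogonal_mul_upperTriangular g
  have hν := isSkewBilin_act h R
  rw [act_mul, ricFunctional_act_of_orthogonal hν hQ]
  have expand : ∀ ν : Vm n, IsSkewBilin ν → ∑ x, (c + d x) * Ric ν x x =
      -c / 4 * normSq ν + 1/4 * ∑ i, ∑ j, ∑ k, (d k - d i - d j) * structConst ν i j k ^ 2 := by
    intro ν hν
    rw [← sum_mul_Ric_diag hν, normSq_eq_neg_four_mul_trace_Ric hν]
    simp only [add_mul, Finset.sum_add_distrib, ← Finset.mul_sum, Matrix.trace, Matrix.diag_apply]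
    ring
  have hT : (Ric μ * Ric μ).trace = -c / 4 * normSq μ := by
    have e := expand μ h
    have z : ∑ i, ∑ j, ∑ k, (d k - d i - d j) * structConst μ i j k ^ 2 = 0 :=
      Finset.sum_eq_zero fun i _ => Finset.sum_eq_zero fun j _ => Finset.sum_eq_zero fun k _ => by
        rw [sq, ← mul_assoc, hs, zero_mul]
    rw [z, mul_zero, add_zero] at e
    rw [trace_sq_of_diagonal hric, ← e]
    refine Finset.sum_congr rfl fun x _ => ?_
    rw [hric, Matrix.diagonal_apply_eq, sq]
  have hN := normSq_pos h hne
  have hN' := normSq_pos hν (act_ne_zero hne R)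
  have hT0 : 0 ≤ (Ric μ * Ric μ).trace := by
    rw [trace_sq_of_diagonal hric]; positivity
  have hc : 0 ≤ -c / 4 := by
    by_contra hc
    nlinarith
  have hge : -c / 4 * normSq (act R μ) ≤ ∑ x, (c + d x) * Ric (act R μ) x x := by
    rw [expand _ hν]
    have : 0 ≤ ∑ i, ∑ j, ∑ k, (d k - d i - d j) * structConst (act R μ) i j k ^ 2 :=
      Finset.sum_nonneg fun i _ => Finset.sum_nonneg fun j _ => Finset.sum_nonneg fun k _ =>
        weight_nonneg_of_upperTriangular h hd hs hR hR' i j k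
    linarith
  have hcs := sq_sum_mul_diag_le (fun x => c + d x) (Ric (act R μ)) (Ric_isSymm _)
  rw [← trace_sq_of_diagonal hric, hT] at hcs
  have hsq := (pow_le_pow_left₀ (by positivity) hge 2).trans hcs
  rw [ricFunctional, ricFunctional, div_le_div_iff₀ (by positivity) (by positivity), hT]
  generalize -c / 4 = q at *
  rcases hc.eq_or_lt with rfl | hq
  · have hTν : 0 ≤ (Ric (act R μ) * Ric (act R μ)).trace := by
      nth_rewrite 1 [← Ric_isSymm]
      simp only [Matrix.trace, Matrix.diag_apply, Matrix.mul_apply, Matrix.transpose_apply]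
      exact Finset.sum_nonneg fun _ _ => Finset.sum_nonneg fun _ _ => mul_self_nonneg _
    rw [zero_mul, zero_mul]
    positivity
  · have h1 : q * normSq (act R μ) ^ 2 ≤ normSq μ * (Ric (act R μ) * Ric (act R μ)).trace := by
      refine le_of_mul_le_mul_left ?_ hq
      linarith
    nlinarith

theorem diagonal_deriv_of_minimal {μ : Vm n} (h : IsSkewBilin μ) (hne : μ ≠ 0)
    {r : Fin n → ℝ} (hric : Ric μ = Matrix.diagonal r)
    (hmin : ∀ g : GL (Fin n) ℝ, ricFunctional μ ≤ ricFunctional (act g μ)) :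
    ∃ c : ℝ, ∀ i j k, ((r k - c) - (r i - c) - (r j - c)) * structConst μ i j k = 0 := by
  have hN := normSq_pos h hne
  set T := (Ric μ * Ric μ).trace with hT
  set N := normSq μ with hNdef
  set c : ℝ := -4 * T / N with hc
  refine ⟨c, ?_⟩
  set s : Fin n → Fin n → Fin n → ℝ := fun i j k => (r k - c) - (r i - c) - (r j - c) with hsdef
  let g : ℝ → GL (Fin n) ℝ := fun t =>
    ⟨Matrix.diagonal fun i => Real.exp (t * (r i - c)),
      Matrix.diagonal fun i => Real.exp (-(t * (r i - c))),
      by simp [Matrix.diagonal_mul_diagonal, ← Real.exp_add],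
      by simp [Matrix.diagonal_mul_diagonal, ← Real.exp_add]⟩
  have hg0 : act (g 0) μ = μ := by
    have : g 0 = 1 := by ext1; simp [g]
    rw [this, act_one]
  have hsc : ∀ t i j k, structConst (act (g t) μ) i j k =
      Real.exp (t * s i j k) * structConst μ i j k := by
    intro t i j k
    have e1 : (g t).1 = Matrix.diagonal fun i => Real.exp (t * (r i - c)) := rfl
    have e2 : (g t)⁻¹.1 = Matrix.diagonal fun i => Real.exp (-(t * (r i - c))) := rfl
    rw [structConst_act h, e1, e2]
    simp only [Matrix.diagonal_apply, ite_mul, mul_ite, zero_mul, mul_zero, Finset.sum_ite_eq,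
      Finset.sum_ite_eq', Finset.mem_univ, if_true]
    rw [← mul_assoc, ← Real.exp_add, ← Real.exp_add]
    congr 2
    simp only [hsdef]
    ring
  have hN' : ∀ t, 0 < normSq (act (g t) μ) := fun t =>
    normSq_pos (isSkewBilin_act h _) (act_ne_zero hne _)
  have hsq : ∀ i j k, HasDerivAt (fun t => structConst (act (g t) μ) i j k ^ 2)
      (2 * s i j k * structConst μ i j k ^ 2) 0 := by
    intro i j k
    simp only [hsc]
    have := ((((hasDerivAt_id (0 : ℝ)).mul_const (s i j k)).exp).mul_const
      (structConst μ i j k)).fun_pow 2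
    refine this.congr_deriv ?_
    simp
    ring
  have hdN : HasDerivAt (fun t => normSq (act (g t) μ))
      (∑ i, ∑ j, ∑ k, 2 * s i j k * structConst μ i j k ^ 2) 0 := by
    have : (fun t => normSq (act (g t) μ)) =
        fun t => ∑ i, ∑ j, ∑ k, structConst (act (g t) μ) i j k ^ 2 := rfl
    rw [this]
    exact HasDerivAt.fun_sum fun i _ => HasDerivAt.fun_sum fun j _ => HasDerivAt.fun_sum
      fun k _ => hsq i j k
  have hdiff : ∀ x y, DifferentiableAt ℝ (fun t => Ric (act (g t) μ) x y) 0 := by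
    intro x y
    have : (fun t => Ric (act (g t) μ) x y) = fun t => -(1/2) * (∑ i, ∑ j,
        structConst (act (g t) μ) x i j * structConst (act (g t) μ) y i j) +
        (1/4) * ∑ i, ∑ j, structConst (act (g t) μ) i j x * structConst (act (g t) μ) i j y := rfl
    rw [this]
    simp only [hsc]
    fun_prop
  have hdiag : HasDerivAt (fun t => ∑ x, r x * Ric (act (g t) μ) x x)
      (1/4 * ∑ i, ∑ j, ∑ k, (r k - r i - r j) * (2 * s i j k * structConst μ i j k ^ 2)) 0 := by
    have : (fun t => ∑ x, r x * Ric (act (g t) μ) x x) = fun t =>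
        1/4 * ∑ i, ∑ j, ∑ k, (r k - r i - r j) * structConst (act (g t) μ) i j k ^ 2 := by
      funext t
      exact sum_mul_Ric_diag (isSkewBilin_act h _) r
    rw [this]
    exact (HasDerivAt.fun_sum fun i _ => HasDerivAt.fun_sum fun j _ => HasDerivAt.fun_sum
      fun k _ => (hsq i j k).const_mul _).const_mul _
  have hdiag' : HasDerivAt (fun t => ∑ x, r x * Ric (act (g t) μ) x x)
      (∑ x, r x * deriv (fun t => Ric (act (g t) μ) x x) 0) 0 :=
    HasDerivAt.fun_sum fun x _ => (hdiff x x).hasDerivAt.const_mul _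
  have hdT : HasDerivAt (fun t => (Ric (act (g t) μ) * Ric (act (g t) μ)).trace)
      (∑ i, ∑ j, ∑ k, (r k - r i - r j) * (s i j k * structConst μ i j k ^ 2)) 0 := by
    have h1 : HasDerivAt (fun t => ∑ x, ∑ y, Ric (act (g t) μ) x y * Ric (act (g t) μ) y x)
        (∑ x, ∑ y, (deriv (fun t => Ric (act (g t) μ) x y) 0 * Ric (act (g 0) μ) y x +
          Ric (act (g 0) μ) x y * deriv (fun t => Ric (act (g t) μ) y x) 0)) 0 :=
      HasDerivAt.fun_sum fun x _ => HasDerivAt.fun_sum fun y _ =>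
        (hdiff x y).hasDerivAt.mul (hdiff y x).hasDerivAt
    refine h1.congr_deriv ?_
    have h2 := hdiag'.unique hdiag
    simp only [hg0, hric, Matrix.diagonal_apply, mul_ite, ite_mul, zero_mul, mul_zero,
      Finset.sum_add_distrib, Finset.sum_ite_eq, Finset.sum_ite_eq', Finset.mem_univ, if_true]
    simp only [mul_comm (deriv _ _), h2]
    simp only [← Finset.sum_add_distrib, Finset.mul_sum]
    refine Finset.sum_congr rfl fun i _ => Finset.sum_congr rfl fun j _ =>
      Finset.sum_congr rfl fun k _ => ?_
    ring
  have hφ := (hdT.mul_const (N ^ 2)).sub ((hdN.fun_pow 2).const_mul T)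
  have hlocmin : IsLocalMin (fun t => (Ric (act (g t) μ) * Ric (act (g t) μ)).trace * N ^ 2 -
      T * normSq (act (g t) μ) ^ 2) 0 := by
    refine Filter.Eventually.of_forall fun t => ?_
    have := hmin (g t)
    rw [ricFunctional, ricFunctional, div_le_div_iff₀ (pow_pos hN 2) (pow_pos (hN' t) 2)] at this
    simp only [hg0]
    rw [← hT, ← hNdef]
    linarith
  have hzero := hlocmin.hasDerivAt_eq_zero hφ
  have hsum : ∑ i, ∑ j, ∑ k, (s i j k * structConst μ i j k) ^ 2 = 0 := by
    have e : ∑ i, ∑ j, ∑ k, (s i j k * structConst μ i j k) ^ 2 =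
        ∑ i, ∑ j, ∑ k, (r k - r i - r j) * (s i j k * structConst μ i j k ^ 2) +
          c / 2 * ∑ i, ∑ j, ∑ k, 2 * s i j k * structConst μ i j k ^ 2 := by
      simp only [Finset.mul_sum, ← Finset.sum_add_distrib]
      refine Finset.sum_congr rfl fun i _ => Finset.sum_congr rfl fun j _ =>
        Finset.sum_congr rfl fun k _ => ?_
      simp only [hsdef]
      ring
    rw [e]
    simp only [hg0, ← hNdef] at hzero
    refine (mul_eq_zero.1 (?_ : N ^ 2 * _ = 0)).resolve_left (pow_pos hN 2).ne'
    have hcN : c * N = -4 * T := by rw [hc]; field_simp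
    rw [← hzero]
    push_cast
    linear_combination (N / 2 * ∑ i, ∑ j, ∑ k, 2 * s i j k * structConst μ i j k ^ 2) * hcN
  intro i j k
  have e1 := (Finset.sum_eq_zero_iff_of_nonneg (fun i _ => by positivity)).1 hsum i
    (Finset.mem_univ i)
  have e2 := (Finset.sum_eq_zero_iff_of_nonneg (fun i _ => by positivity)).1 e1 j
    (Finset.mem_univ j)
  have e3 := (Finset.sum_eq_zero_iff_of_nonneg (fun i _ => by positivity)).1 e2 k
    (Finset.mem_univ k)
  exact pow_eq_zero_iff two_ne_zero |>.1 e3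

end Bracket

/-- for a nonzero nilpotent Lie bracket `μ` on `ℝⁿ`, the metric `μ` minimizes
`tr(Ric²)/‖·‖⁴` along its `GL(n,ℝ)`-orbit iff `Ric_μ = cI + D` with `D` a derivation. -/
theorem minimal_iff_Ric_eq_scalar_add_deriv (n : ℕ) (μ : Vm n)
    (hskew : IsSkewBilin μ) (hjac : Jacobi μ) (hnil : IsNilp μ) (hne : μ ≠ 0) :
    (∀ g : GL (Fin n) ℝ,
        Matrix.trace (Ric μ * Ric μ) / (normSq μ) ^ 2 ≤
          Matrix.trace (Ric (act g μ) * Ric (act g μ)) / (normSq (act g μ)) ^ 2) ↔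
      (∃ (c : ℝ) (D : Matrix (Fin n) (Fin n) ℝ),
        Ric μ = c • (1 : Matrix (Fin n) (Fin n) ℝ) + D ∧ IsDeriv μ D) := by
  open Bracket in
  obtain ⟨U, d, hU, hd, hdiag⟩ := exists_orthogonal_diagonalization (Ric_isSymm μ)
  have hU' := inv_orthogonal hU
  have hUU : U⁻¹.1 * U.1 = 1 := U.inv_mul
  have hskew' := isSkewBilin_act hskew U⁻¹
  have hne' := act_ne_zero hne U⁻¹
  have hback : act U (act U⁻¹ μ) = μ := by rw [← act_mul, mul_inv_cancel, act_one]
  have hinv := ricFunctional_act_of_orthogonal hskew hU'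
  have hric : Ric (act U⁻¹ μ) = Matrix.diagonal d := by
    have e : U⁻¹.1ᵀ = U.1 := by rw [hU, Matrix.transpose_transpose]
    rw [Ric_act_of_orthogonal hskew hU', e, hdiag]
    simp only [Matrix.mul_assoc, hUU, Matrix.mul_one]
    rw [← Matrix.mul_assoc, hUU, Matrix.one_mul]
  change (∀ g : GL (Fin n) ℝ, ricFunctional μ ≤ ricFunctional (act g μ)) ↔ _
  constructor
  · intro hmin
    obtain ⟨c, hc⟩ := diagonal_deriv_of_minimal hskew' hne' hric fun g => by
      rw [hinv, ← act_mul]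
      exact hmin _
    refine ⟨c, U.1 * Matrix.diagonal (fun i => d i - c) * U⁻¹.1, ?_, ?_⟩
    · have e : (Matrix.diagonal fun i => d i - c) =
          Matrix.diagonal d - c • (1 : Matrix (Fin n) (Fin n) ℝ) := by
        rw [Matrix.smul_one_eq_diagonal, Matrix.diagonal_sub]
      have hUU' : U.1 * U⁻¹.1 = 1 := U.mul_inv
      rw [e, Matrix.mul_sub, Matrix.sub_mul, ← hdiag, Matrix.mul_smul, Matrix.smul_mul,
        Matrix.mul_one, hUU']
      abel
    · have := isDeriv_act ((isDeriv_diagonal_iff hskew' _).2 hc) U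
      rwa [hback] at this
  · rintro ⟨c, D, hD, hder⟩ g
    have hderiv := isDeriv_act hder U⁻¹
    have e : U⁻¹.1 * D * U⁻¹⁻¹.1 = Matrix.diagonal fun i => d i - c := by
      have hD' : D = Ric μ - c • (1 : Matrix (Fin n) (Fin n) ℝ) := by rw [hD]; abel
      rw [inv_inv, hD', Matrix.mul_sub, Matrix.sub_mul, Matrix.mul_smul, Matrix.smul_mul,
        Matrix.mul_one, hUU, Matrix.smul_one_eq_diagonal]
      have := Ric_act_of_orthogonal hskew hU'
      rw [hric, hU, Matrix.transpose_transpose, ← hU] at this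
      rw [← this, Matrix.diagonal_sub]
    rw [e, isDeriv_diagonal_iff hskew'] at hderiv
    have := ricFunctional_le_of_diagonal hskew' hne' (c := c)
      (fun i j hij => sub_le_sub_right (hd hij) c) (by simpa using hric) hderiv (g * U)
    rwa [hinv, act_mul, hback] at this
end

section
/- Let μ ≠ 0 be a nilpotent Lie bracket on ℝⁿ with Ric_μ = cI + D for some c ∈ ℝ and D ∈ Der(μ), and let g ∈ GL(n,ℝ) be such that Ric_{g·μ} = c′I + D′ for some c′ ∈ ℝ and D′ ∈ Der(g·μ). Then there exist r ∈ ℝ, r ≠ 0, and an orthogonal map k ∈ O(n) such that g·μ = r (k·μ). -/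
open scoped BigOperators Matrix

section Brackets

variable {n : ℕ} {μ ν : Vm n}

theorem IsSkewBilin.smul_left (h : IsSkewBilin μ) (c : ℝ) (X Y : Fin n → ℝ) :
    μ (c • X) Y = c • μ X Y := by
  have h0 : μ 0 Y = 0 := by simpa using h.1 1 0 0 Y
  simpa [h0] using h.1 c X 0 Y

theorem IsSkewBilin.smul_right (h : IsSkewBilin μ) (c : ℝ) (X Y : Fin n → ℝ) :
    μ X (c • Y) = c • μ X Y := by
  have h0 : μ X 0 = 0 := by simpa using h.2.1 1 X 0 0
  simpa [h0] using h.2.1 c X Y 0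

theorem IsSkewBilin.apply_eq_sum (h : IsSkewBilin μ) (X Y : Fin n → ℝ) :
    μ X Y = ∑ i, ∑ j, (X i * Y j) • μ (stdb n i) (stdb n j) := by
  let B : (Fin n → ℝ) →ₗ[ℝ] (Fin n → ℝ) →ₗ[ℝ] (Fin n → ℝ) := LinearMap.mk₂ ℝ μ
    (fun X X' Y => by simpa using h.1 1 X X' Y)
    h.smul_left
    (fun X Y Y' => by simpa using h.2.1 1 X Y Y')
    h.smul_right
  have hB (X Y) : B X Y = μ X Y := rfl
  have hs (X : Fin n → ℝ) : X = ∑ i, X i • stdb n i := pi_eq_sum_univ' X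
  rw [← hB]
  conv_lhs => rw [hs X, hs Y]
  simp only [map_sum, map_smul, LinearMap.sum_apply, LinearMap.smul_apply, hB, Finset.smul_sum,
    smul_smul]
  rw [Finset.sum_comm]
  simp only [mul_comm]

theorem IsSkewBilin.ext_stdb (hμ : IsSkewBilin μ) (hν : IsSkewBilin ν)
    (h : ∀ i j, μ (stdb n i) (stdb n j) = ν (stdb n i) (stdb n j)) : μ = ν := by
  funext X Y
  rw [hμ.apply_eq_sum, hν.apply_eq_sum]
  simp only [h]

theorem IsSkewBilin.act (h : IsSkewBilin μ) (g : GL (Fin n) ℝ) : IsSkewBilin (act g μ) := by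
  obtain ⟨h1, h2, h3⟩ := h
  refine ⟨fun c X X' Y => ?_, fun c X Y Y' => ?_, fun X Y => ?_⟩
  · simp only [_root_.act, Matrix.mulVec_add, Matrix.mulVec_smul, h1]
  · simp only [_root_.act, Matrix.mulVec_add, Matrix.mulVec_smul, h2]
  · simp only [_root_.act]
    rw [h3, Matrix.mulVec_neg]

theorem act_mul (g h : GL (Fin n) ℝ) (μ : Vm n) : act (g * h) μ = act g (act h μ) := by
  funext X Y
  simp [act, Matrix.mulVec_mulVec, mul_inv_rev]

theorem act_one (μ : Vm n) : act 1 μ = μ := by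
  funext X Y
  simp [act]

theorem eq_act_of_forall_stdb (hμ : IsSkewBilin μ) (hν : IsSkewBilin ν) (g : GL (Fin n) ℝ)
    (h : ∀ i j, g.1.mulVec (μ (stdb n i) (stdb n j)) =
      ν (g.1.mulVec (stdb n i)) (g.1.mulVec (stdb n j))) : ν = act g μ := by
  have h' : μ = act g⁻¹ ν := by
    refine hμ.ext_stdb (hν.act _) fun i j => ?_
    simp only [act, inv_inv, ← h, Matrix.mulVec_mulVec]
    simp
  rw [h', ← act_mul, mul_inv_cancel, act_one]

theorem mulVec_apply_eq_act (g : GL (Fin n) ℝ) (μ : Vm n) (X Y : Fin n → ℝ) :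
    g.1.mulVec (μ X Y) = act g μ (g.1.mulVec X) (g.1.mulVec Y) := by
  simp only [act, Matrix.mulVec_mulVec]
  simp

theorem mulVec_stdb (M : Matrix (Fin n) (Fin n) ℝ) (i a : Fin n) :
    M.mulVec (stdb n i) a = M a i := by
  simp [stdb]

theorem act_stdb_apply (hμ : IsSkewBilin μ) (g : GL (Fin n) ℝ) (a b k : Fin n) :
    act g μ (stdb n a) (stdb n b) k =
      ∑ l, g.1 k l * ∑ i, ∑ j, g⁻¹.1 i a * g⁻¹.1 j b * μ (stdb n i) (stdb n j) l := by
  rw [act, hμ.apply_eq_sum]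
  simp only [mulVec_stdb]
  simp only [Matrix.mulVec, dotProduct, Finset.sum_apply, Pi.smul_apply, smul_eq_mul]

theorem IsDeriv.act {D : Matrix (Fin n) (Fin n) ℝ} (h : IsDeriv μ D) (g : GL (Fin n) ℝ) :
    IsDeriv (act g μ) (g.1 * D * g⁻¹.1) := by
  intro X Y
  have e (Z : Fin n → ℝ) : g⁻¹.1.mulVec (g.1.mulVec Z) = Z := by
    rw [Matrix.mulVec_mulVec]; simp
  simp only [_root_.act, ← Matrix.mulVec_mulVec, e, h _ _, Matrix.mulVec_add]

theorem IsDeriv.diagonal_weight {d : Fin n → ℝ} (hμ : IsSkewBilin μ)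
    (h : IsDeriv μ (Matrix.diagonal d)) (i j k : Fin n)
    (hne : μ (stdb n i) (stdb n j) k ≠ 0) : d k = d i + d j := by
  have e (i : Fin n) : (Matrix.diagonal d).mulVec (stdb n i) = d i • stdb n i := by
    ext a
    simp [stdb, Pi.single_apply]
  have := congrFun (h (stdb n i) (stdb n j)) k
  rw [e, e, hμ.smul_left, hμ.smul_right, Matrix.mulVec_diagonal] at this
  apply mul_right_cancel₀ hne
  rw [this]
  simp
  ring

/-- The matrix of `ad e_a`. -/
noncomputable def adMat (μ : Vm n) (a : Fin n) : Matrix (Fin n) (Fin n) ℝ :=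
  Matrix.of fun j i => μ (stdb n a) (stdb n i) j

theorem adMat_act (hμ : IsSkewBilin μ) (g : GL (Fin n) ℝ) (x : Fin n) :
    adMat (act g μ) x = ∑ a, g⁻¹.1 a x • (g.1 * adMat μ a * g⁻¹.1) := by
  ext j i
  simp only [adMat, Matrix.of_apply, act_stdb_apply hμ, Matrix.sum_apply, Matrix.smul_apply,
    Matrix.mul_apply, smul_eq_mul, Finset.mul_sum, Finset.sum_mul]
  rw [Finset.sum_comm]
  refine Finset.sum_congr rfl fun a _ => ?_
  rw [Finset.sum_comm]
  refine Finset.sum_congr rfl fun b _ => ?_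
  refine Finset.sum_congr rfl fun l _ => ?_
  ring

theorem Ric_apply_eq (μ : Vm n) (x y : Fin n) :
    Ric μ x y = -(1/2) * ((adMat μ x)ᵀ * adMat μ y).trace
      + (1/4) * (∑ i, adMat μ i * (adMat μ i)ᵀ) x y := by
  simp [Ric, adMat, Matrix.trace, Matrix.mul_apply, Matrix.sum_apply]

theorem normSq_eq (μ : Vm n) : normSq μ = ∑ i, ((adMat μ i)ᵀ * adMat μ i).trace := by
  simp [normSq, adMat, Matrix.trace, Matrix.mul_apply, sq]

section Orthogonal

variable {k : GL (Fin n) ℝ}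

theorem inv_eq_transpose (hk : k.1ᵀ * k.1 = 1) : k⁻¹.1 = k.1ᵀ :=
  Units.inv_eq_of_mul_eq_one_left hk

theorem orthogonal_inv (hk : k.1ᵀ * k.1 = 1) : k⁻¹.1ᵀ * k⁻¹.1 = 1 := by
  rw [inv_eq_transpose hk, Matrix.transpose_transpose]
  exact mul_eq_one_comm.1 hk

theorem orthogonal_mul {l : GL (Fin n) ℝ} (hk : k.1ᵀ * k.1 = 1) (hl : l.1ᵀ * l.1 = 1) :
    (k * l).1ᵀ * (k * l).1 = 1 := by
  rw [Units.val_mul, Matrix.transpose_mul, Matrix.mul_assoc, ← Matrix.mul_assoc k.1ᵀ, hk,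
    Matrix.one_mul, hl]

theorem adMat_act_orthogonal (hμ : IsSkewBilin μ) (hk : k.1ᵀ * k.1 = 1) (x : Fin n) :
    adMat (act k μ) x = ∑ a, k.1 x a • (k.1 * adMat μ a * k.1ᵀ) := by
  simp [adMat_act hμ, inv_eq_transpose hk]

theorem trace_adMat_act_orthogonal (hμ : IsSkewBilin μ) (hk : k.1ᵀ * k.1 = 1) (x y : Fin n) :
    ((adMat (act k μ) x)ᵀ * adMat (act k μ) y).trace =
      ∑ a, ∑ b, k.1 x a * k.1 y b * ((adMat μ a)ᵀ * adMat μ b).trace := by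
  have key (a b : Fin n) : ((k.1 * adMat μ a * k.1ᵀ)ᵀ * (k.1 * adMat μ b * k.1ᵀ)).trace =
      ((adMat μ a)ᵀ * adMat μ b).trace := by
    have : (k.1 * adMat μ a * k.1ᵀ)ᵀ * (k.1 * adMat μ b * k.1ᵀ) =
        k.1 * ((adMat μ a)ᵀ * (k.1ᵀ * k.1) * adMat μ b) * k.1ᵀ := by
      simp only [Matrix.transpose_mul, Matrix.transpose_transpose, Matrix.mul_assoc]
    rw [this, hk, Matrix.trace_mul_cycle, hk, Matrix.mul_one, Matrix.one_mul]
  simp only [adMat_act_orthogonal hμ hk, Matrix.transpose_sum, Matrix.transpose_smul,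
    Finset.sum_mul, Finset.mul_sum, Matrix.smul_mul, Matrix.mul_smul, Matrix.trace_sum,
    Matrix.trace_smul, key, smul_eq_mul]
  rw [Finset.sum_comm]
  exact Finset.sum_congr rfl fun a _ => Finset.sum_congr rfl fun b _ => by ring

theorem sum_orthogonal_mul {k : Matrix (Fin n) (Fin n) ℝ} (hk : kᵀ * k = 1) (a b : Fin n) :
    ∑ i, k i a * k i b = if a = b then 1 else 0 := by
  have := congrFun (congrFun hk a) b
  simpa [Matrix.mul_apply, Matrix.one_apply] using this

theorem normSq_act_orthogonal (hμ : IsSkewBilin μ) (hk : k.1ᵀ * k.1 = 1) :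
    normSq (act k μ) = normSq μ := by
  simp only [normSq_eq, trace_adMat_act_orthogonal hμ hk]
  rw [Finset.sum_comm]
  refine Finset.sum_congr rfl fun a _ => ?_
  rw [Finset.sum_comm]
  simp only [← Finset.sum_mul, sum_orthogonal_mul hk]
  simp

theorem sum_adMat_act_orthogonal (hμ : IsSkewBilin μ) (hk : k.1ᵀ * k.1 = 1) :
    ∑ i, adMat (act k μ) i * (adMat (act k μ) i)ᵀ =
      k.1 * (∑ i, adMat μ i * (adMat μ i)ᵀ) * k.1ᵀ := by
  have key (a b : Fin n) : (k.1 * adMat μ a * k.1ᵀ) * (k.1 * adMat μ b * k.1ᵀ)ᵀ =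
      k.1 * (adMat μ a * (adMat μ b)ᵀ) * k.1ᵀ := by
    have : (k.1 * adMat μ a * k.1ᵀ) * (k.1 * adMat μ b * k.1ᵀ)ᵀ =
        k.1 * (adMat μ a * (k.1ᵀ * k.1) * (adMat μ b)ᵀ) * k.1ᵀ := by
      simp only [Matrix.transpose_mul, Matrix.transpose_transpose, Matrix.mul_assoc]
    rw [this, hk, Matrix.mul_one]
  simp only [adMat_act_orthogonal hμ hk, Matrix.transpose_sum, Matrix.transpose_smul,
    Finset.sum_mul, Finset.mul_sum, Matrix.smul_mul, Matrix.mul_smul, key, smul_smul]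
  rw [Finset.sum_comm]
  refine Finset.sum_congr rfl fun a _ => ?_
  rw [Finset.sum_comm]
  simp only [← Finset.sum_smul, sum_orthogonal_mul hk]
  simp

theorem Ric_act_orthogonal (hμ : IsSkewBilin μ) (hk : k.1ᵀ * k.1 = 1) :
    Ric (act k μ) = k.1 * Ric μ * k.1ᵀ := by
  have h : Ric μ = -(1/2 : ℝ) • (Matrix.of fun x y => ((adMat μ x)ᵀ * adMat μ y).trace)
      + (1/4 : ℝ) • (∑ i, adMat μ i * (adMat μ i)ᵀ) := by
    ext x y
    simp [Ric_apply_eq]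
  ext x y
  rw [Ric_apply_eq, trace_adMat_act_orthogonal hμ hk, sum_adMat_act_orthogonal hμ hk, h,
    Matrix.mul_add, Matrix.add_mul, Matrix.mul_smul, Matrix.smul_mul, Matrix.mul_smul,
    Matrix.smul_mul, Matrix.add_apply, Matrix.smul_apply, Matrix.smul_apply, smul_eq_mul,
    smul_eq_mul]
  congr 2
  simp only [Matrix.mul_apply (M := k.1 * _), Matrix.mul_apply (M := k.1), Finset.sum_mul,
    Matrix.of_apply, Matrix.transpose_apply k.1]
  rw [Finset.sum_comm]
  exact Finset.sum_congr rfl fun a _ => Finset.sum_congr rfl fun b _ => by ring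

end Orthogonal

theorem sum_mul_Ric_diag (hμ : IsSkewBilin μ) (a : Fin n → ℝ) :
    ∑ i, a i * Ric μ i i =
      (1/4) * ∑ i, ∑ j, ∑ k, (a k - a i - a j) * μ (stdb n i) (stdb n j) k ^ 2 := by
  have hs (i j k : Fin n) : μ (stdb n i) (stdb n j) k ^ 2 = μ (stdb n j) (stdb n i) k ^ 2 := by
    rw [hμ.2.2 (stdb n i)]
    simp
  set C : Fin n → Fin n → Fin n → ℝ := fun i j k => μ (stdb n i) (stdb n j) k ^ 2 with hC
  have h1 : ∑ i, ∑ j, ∑ k, a j * C i j k = ∑ i, ∑ j, ∑ k, a i * C i j k := by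
    rw [Finset.sum_comm]
    simp only [hC, hs]
  have h2 : ∑ i, ∑ j, ∑ k, a k * C i j k = ∑ k, ∑ i, ∑ j, a k * C i j k := by
    rw [Finset.sum_comm_cycle]
  have h3 : ∑ i, a i * Ric μ i i =
      -(1/2) * ∑ i, ∑ j, ∑ k, a i * C i j k + (1/4) * ∑ k, ∑ i, ∑ j, a k * C i j k := by
    simp only [← Finset.mul_sum, Ric, Matrix.of_apply, mul_add, Finset.sum_add_distrib, hC, sq]
    rw [Finset.mul_sum, Finset.mul_sum]
    congr 1 <;> exact Finset.sum_congr rfl fun i _ => by ring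
  simp only [sub_mul, Finset.sum_sub_distrib]
  rw [h3, ← h2]
  change _ = 1 / 4 * (∑ i, ∑ j, ∑ k, a k * C i j k - ∑ i, ∑ j, ∑ k, a i * C i j k -
    ∑ i, ∑ j, ∑ k, a j * C i j k)
  rw [h1]
  ring

theorem sum_Ric_diag (hμ : IsSkewBilin μ) : ∑ i, Ric μ i i = -(1/4) * normSq μ := by
  have := sum_mul_Ric_diag hμ (fun _ => 1)
  simp only [one_mul] at this
  rw [this, normSq]
  simp

theorem Ric_isHermitian (μ : Vm n) : (Ric μ).IsHermitian := by
  ext x y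
  simp [Ric, mul_comm]

theorem exists_orthogonal_diagonalization {S : Matrix (Fin n) (Fin n) ℝ} (hS : S.IsHermitian) :
    ∃ (u : GL (Fin n) ℝ) (d : Fin n → ℝ), u.1ᵀ * u.1 = 1 ∧
      u.1 * S * u.1ᵀ = Matrix.diagonal d := by
  have h1 := Matrix.mem_unitaryGroup_iff.1 hS.eigenvectorUnitary.2
  have h2 := Matrix.mem_unitaryGroup_iff'.1 hS.eigenvectorUnitary.2
  set V : Matrix (Fin n) (Fin n) ℝ := hS.eigenvectorUnitary.1 with hV
  rw [Matrix.star_eq_conjTranspose, Matrix.conjTranspose_eq_transpose_of_trivial] at h1 h2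
  refine ⟨⟨Vᵀ, V, h2, h1⟩, hS.eigenvalues, by simpa using h1, ?_⟩
  have := hS.spectral_theorem
  rw [Unitary.conjStarAlgAut_apply, ← hV, Matrix.star_eq_conjTranspose,
    Matrix.conjTranspose_eq_transpose_of_trivial] at this
  simp only [Matrix.transpose_transpose]
  conv_lhs => rw [this]
  rw [Matrix.mul_assoc, Matrix.mul_assoc _ _ V, h2, ← Matrix.mul_assoc, ← Matrix.mul_assoc, h2]
  simp

/-- `QR` decomposition adapted to the order given by `b`. -/
theorem exists_orthogonal_mul_blockTriangular (g : GL (Fin n) ℝ) (b : Fin n → ℝ) :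
    ∃ k : GL (Fin n) ℝ, k.1ᵀ * k.1 = 1 ∧ (k.1 * g.1).BlockTriangular b := by
  let σ := Tuple.sort b
  let f : Fin n → EuclideanSpace ℝ (Fin n) := fun i => WithLp.toLp 2 fun r => g.1 r (σ i)
  have hc : Module.finrank ℝ (EuclideanSpace ℝ (Fin n)) = Fintype.card (Fin n) := by simp
  let B := InnerProductSpace.gramSchmidtOrthonormalBasis hc f
  let K : Matrix (Fin n) (Fin n) ℝ := Matrix.of fun i r => B (σ.symm i) r
  have hK : K * Kᵀ = 1 := by
    ext i j
    have := orthonormal_iff_ite.1 B.orthonormal (σ.symm i) (σ.symm j)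
    simp only [EmbeddingLike.apply_eq_iff_eq] at this
    rw [Matrix.one_apply, ← this]
    simp [K, Matrix.mul_apply, PiLp.inner_apply, mul_comm]
  have hK' : Kᵀ * K = 1 := mul_eq_one_comm.1 hK
  refine ⟨⟨K, Kᵀ, hK, hK'⟩, hK', fun i j hij => ?_⟩
  have hlt : σ.symm j < σ.symm i := by
    by_contra! hle
    have := Tuple.monotone_sort b hle
    simp only [Function.comp_apply] at this
    change b (σ _) ≤ b (σ _) at this
    simp only [Equiv.apply_symm_apply] at this
    exact absurd hij this.not_gt
  have := InnerProductSpace.gramSchmidtOrthonormalBasis_inv_triangular hc f hlt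
  rw [← this]
  simp [K, Matrix.mul_apply, PiLp.inner_apply, f, B, mul_comm]

/-- A positive diagonal matrix preserving the diagonal of `Ric` fixes `μ`. -/
theorem act_diagonal_eq_self (hμ : IsSkewBilin μ) (E : GL (Fin n) ℝ) (e : Fin n → ℝ)
    (he : ∀ i, 0 < e i) (hE : E.1 = Matrix.diagonal e)
    (h : ∀ i, Ric (act E μ) i i = Ric μ i i) : act E μ = μ := by
  have hinv : E⁻¹.1 = Matrix.diagonal (fun i => (e i)⁻¹) := by
    refine Units.inv_eq_of_mul_eq_one_left ?_
    simp [hE, Matrix.diagonal_mul_diagonal, (he _).ne']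
  let w : Fin n → Fin n → Fin n → ℝ := fun i j k => Real.log (e k) - Real.log (e i) - Real.log (e j)
  have hC (i j k : Fin n) : act E μ (stdb n i) (stdb n j) k =
      Real.exp (w i j k) * μ (stdb n i) (stdb n j) k := by
    rw [act_stdb_apply hμ, hE, hinv]
    simp only [w, Real.exp_sub, Real.exp_log (he _), Matrix.diagonal_apply, ite_mul, zero_mul,
      mul_ite, mul_zero, Finset.sum_ite_eq, Finset.sum_ite_eq', Finset.mem_univ, if_true]
    field_simp
  have h1 := sum_mul_Ric_diag hμ (fun i => Real.log (e i))
  have h2 := sum_mul_Ric_diag (hμ.act E) (fun i => Real.log (e i))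
  simp only [h] at h2
  have hsum : ∑ i, ∑ j, ∑ k, w i j k * (Real.exp (w i j k) ^ 2 - 1) *
      μ (stdb n i) (stdb n j) k ^ 2 = 0 := by
    simp only [mul_sub, sub_mul, Finset.sum_sub_distrib, mul_one]
    rw [h1] at h2
    simp only [hC, mul_pow] at h2
    simp only [mul_assoc]
    linarith
  have hnn (x : ℝ) : 0 ≤ x * (Real.exp x ^ 2 - 1) := by
    rcases le_total 0 x with hx | hx
    · exact mul_nonneg hx (by nlinarith [Real.one_le_exp hx])
    · refine mul_nonneg_of_nonpos_of_nonpos hx ?_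
      nlinarith [Real.exp_le_one_iff.2 hx, Real.exp_pos x]
  have hnn' (i j k : Fin n) : 0 ≤ w i j k * (Real.exp (w i j k) ^ 2 - 1) *
      μ (stdb n i) (stdb n j) k ^ 2 := mul_nonneg (hnn _) (sq_nonneg _)
  refine (hμ.act E).ext_stdb hμ fun i j => funext fun k => ?_
  have h0 : w i j k * (Real.exp (w i j k) ^ 2 - 1) * μ (stdb n i) (stdb n j) k ^ 2 = 0 := by
    have a1 := (Finset.sum_eq_zero_iff_of_nonneg fun i _ => Finset.sum_nonneg fun j _ =>
      Finset.sum_nonneg fun k _ => hnn' i j k).1 hsum i (Finset.mem_univ _)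
    have a2 := (Finset.sum_eq_zero_iff_of_nonneg fun j _ =>
      Finset.sum_nonneg fun k _ => hnn' i j k).1 a1 j (Finset.mem_univ _)
    exact (Finset.sum_eq_zero_iff_of_nonneg fun k _ => hnn' i j k).1 a2 k (Finset.mem_univ _)
  rw [hC]
  rcases mul_eq_zero.1 h0 with h0 | h0
  · have : w i j k = 0 := by
      rcases mul_eq_zero.1 h0 with h0 | h0
      · exact h0
      · have h3 : Real.exp (w i j k) = 1 := by
          nlinarith [Real.exp_pos (w i j k)]
        simpa using h3
    simp [this]
  · have : μ (stdb n i) (stdb n j) k = 0 := by simpa using h0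
    simp [this]

theorem exists_orthogonal_of_commute_Ric (hμ : IsSkewBilin μ) (q : GL (Fin n) ℝ)
    (hq : q.1 * Ric μ = Ric μ * q.1) (h : Ric (act q μ) = Ric μ) :
    ∃ k : GL (Fin n) ℝ, k.1ᵀ * k.1 = 1 ∧ act q μ = act k μ := by
  obtain ⟨u, d, hu, hd⟩ := exists_orthogonal_diagonalization
    (Matrix.isHermitian_conjTranspose_mul_self q.1)
  rw [Matrix.conjTranspose_eq_transpose_of_trivial] at hd
  have hd' : Matrix.diagonal d = ((q * u⁻¹).1)ᵀ * (q * u⁻¹).1 := by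
    rw [← hd, Units.val_mul, inv_eq_transpose hu]
    simp only [Matrix.transpose_mul, Matrix.transpose_transpose, Matrix.mul_assoc]
  have hpos : ∀ i, 0 < d i := by
    apply Matrix.posDef_diagonal_iff.1
    rw [hd', ← Matrix.conjTranspose_eq_transpose_of_trivial]
    exact Matrix.PosDef.conjTranspose_mul_self _
      (Matrix.mulVec_injective_iff_isUnit.2 (q * u⁻¹).isUnit)
  let e : Fin n → ℝ := fun i => √(d i)
  have he : ∀ i, 0 < e i := fun i => Real.sqrt_pos.2 (hpos i)
  have hee : Matrix.diagonal e * Matrix.diagonal e = Matrix.diagonal d := by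
    simp [e, Matrix.diagonal_mul_diagonal, Real.mul_self_sqrt (hpos _).le]
  let E : GL (Fin n) ℝ := ⟨Matrix.diagonal e, Matrix.diagonal fun i => (e i)⁻¹,
    by simp [Matrix.diagonal_mul_diagonal, (he _).ne'],
    by simp [Matrix.diagonal_mul_diagonal, (he _).ne']⟩
  have hE : E.1 = Matrix.diagonal e := rfl
  have hEi : E⁻¹.1ᵀ = E⁻¹.1 := Matrix.diagonal_transpose _
  let k : GL (Fin n) ℝ := q * u⁻¹ * E⁻¹
  have hk : k.1ᵀ * k.1 = 1 := by
    have : k.1ᵀ * k.1 = E⁻¹.1 * (E.1 * E.1) * E⁻¹.1 := by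
      rw [hE, hee, hd', Units.val_mul (q * u⁻¹) E⁻¹, Matrix.transpose_mul, hEi]
      simp only [Matrix.mul_assoc]
    rw [this, ← Units.val_mul, ← Units.val_mul, ← Units.val_mul]
    simp
  have hqk : q = k * (E * u) := by simp [k, mul_assoc]
  have hEk : E * u = k⁻¹ * q := by rw [hqk]; simp
  have hfix : act E (act u μ) = act u μ := by
    refine act_diagonal_eq_self (hμ.act u) E e he hE fun i => ?_
    rw [← act_mul, hEk, act_mul, Ric_act_orthogonal (hμ.act q) (orthogonal_inv hk), h,
      Ric_act_orthogonal hμ hu, ← inv_eq_transpose (orthogonal_inv hk), inv_inv]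
    have hki : k⁻¹ = E * u * q⁻¹ := by rw [hEk]; simp
    have : k⁻¹.1 * Ric μ * k.1 = Matrix.diagonal e * (u.1 * Ric μ * u.1ᵀ) *
        Matrix.diagonal fun i => (e i)⁻¹ := by
      have hq' : q⁻¹.1 * Ric μ * q.1 = Ric μ := by
        rw [Matrix.mul_assoc, ← hq, ← Matrix.mul_assoc, ← Units.val_mul]
        simp
      have : k⁻¹.1 * Ric μ * k.1 = E.1 * (u.1 * (q⁻¹.1 * Ric μ * q.1) * u⁻¹.1) * E⁻¹.1 := by
        rw [hki]
        simp only [k, Units.val_mul, Matrix.mul_assoc]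
      rw [this, hq', inv_eq_transpose hu]
      rfl
    rw [this, Matrix.mul_diagonal, Matrix.diagonal_mul]
    field_simp [(he i).ne']
  refine ⟨k * u, orthogonal_mul hk hu, ?_⟩
  rw [act_mul k u, ← hfix, ← act_mul E u, ← act_mul k, ← hqk]

/-- Squared Frobenius norm. -/
noncomputable def frobSq (A : Matrix (Fin n) (Fin n) ℝ) : ℝ := (Aᵀ * A).trace

theorem frobSq_orthogonal_conj {k : Matrix (Fin n) (Fin n) ℝ} (hk : kᵀ * k = 1)
    (A : Matrix (Fin n) (Fin n) ℝ) : frobSq (k * A * kᵀ) = frobSq A := by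
  have : (k * A * kᵀ)ᵀ * (k * A * kᵀ) = k * (Aᵀ * (kᵀ * k) * A) * kᵀ := by
    simp only [Matrix.transpose_mul, Matrix.transpose_transpose, Matrix.mul_assoc]
  rw [frobSq, this, hk, Matrix.trace_mul_cycle, hk, Matrix.mul_one, Matrix.one_mul, frobSq]

theorem frobSq_nonneg (A : Matrix (Fin n) (Fin n) ℝ) : 0 ≤ frobSq A := by
  simp only [frobSq, Matrix.trace, Matrix.mul_apply, Matrix.diag_apply, Matrix.transpose_apply]
  exact Finset.sum_nonneg fun i _ => Finset.sum_nonneg fun j _ => mul_self_nonneg _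

theorem eq_zero_of_frobSq_eq_zero {A : Matrix (Fin n) (Fin n) ℝ} (h : frobSq A = 0) : A = 0 := by
  rw [frobSq, ← Matrix.conjTranspose_eq_transpose_of_trivial] at h
  exact Matrix.trace_conjTranspose_mul_self_eq_zero_iff.1 h

theorem frobSq_sub_diagonal (A : Matrix (Fin n) (Fin n) ℝ) (r : Fin n → ℝ) :
    frobSq (A - Matrix.diagonal r) =
      frobSq A + frobSq (Matrix.diagonal r) - 2 * ∑ i, r i * A i i := by
  simp only [frobSq, Matrix.transpose_sub, Matrix.diagonal_transpose, Matrix.sub_mul,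
    Matrix.mul_sub, Matrix.trace_sub]
  have h1 : (Aᵀ * Matrix.diagonal r).trace = ∑ i, r i * A i i := by
    simp [Matrix.trace, mul_comm]
  have h2 : (Matrix.diagonal r * A).trace = ∑ i, r i * A i i := by
    simp [Matrix.trace]
  rw [h1, h2]
  ring


theorem minimal_diagonal_case (hμ : IsSkewBilin μ) {c : ℝ} {d : Fin n → ℝ}
    (hRic : Ric μ = c • (1 : Matrix (Fin n) (Fin n) ℝ) + Matrix.diagonal d)
    (hD : IsDeriv μ (Matrix.diagonal d)) (p : GL (Fin n) ℝ)
    (hp : p.1.BlockTriangular fun i => -d i) (hN : normSq (act p μ) = normSq μ) :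
    frobSq (Ric μ) ≤ frobSq (Ric (act p μ)) ∧
      (frobSq (Ric (act p μ)) = frobSq (Ric μ) →
        ∃ k : GL (Fin n) ℝ, k.1ᵀ * k.1 = 1 ∧ act p μ = act k μ) := by
  have hν := hμ.act p
  set ν := act p μ with hνdef
  have hR : Ric μ = Matrix.diagonal fun i => c + d i := by
    rw [hRic, ← Matrix.diagonal_one, ← Matrix.diagonal_smul, Matrix.diagonal_add]
    simp
  have hRii (i) : Ric μ i i = c + d i := by simp [hR]
  have hp1 (i j) (h : p.1 i j ≠ 0) : d j ≤ d i := by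
    by_contra! hlt
    exact h (hp (neg_lt_neg hlt))
  have hpi : p⁻¹.1.BlockTriangular fun i => -d i := by
    have : Invertible p.1 := p.invertible
    rw [Matrix.coe_units_inv]
    exact Matrix.blockTriangular_inv_of_blockTriangular hp
  have hp2 (i j) (h : p⁻¹.1 i j ≠ 0) : d j ≤ d i := by
    by_contra! hlt
    exact h (hpi (neg_lt_neg hlt))
  have hwμ := hD.diagonal_weight hμ
  have hwν (a b k : Fin n) (h : ν (stdb n a) (stdb n b) k ≠ 0) : d a + d b ≤ d k := by
    rw [hνdef, act_stdb_apply hμ] at h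
    simp only [Finset.mul_sum] at h
    obtain ⟨l, -, hl⟩ := Finset.exists_ne_zero_of_sum_ne_zero h
    obtain ⟨i, -, hi⟩ := Finset.exists_ne_zero_of_sum_ne_zero hl
    obtain ⟨j, -, hj⟩ := Finset.exists_ne_zero_of_sum_ne_zero hi
    have h1 := hp1 _ _ (left_ne_zero_of_mul hj)
    have h2 := right_ne_zero_of_mul hj
    have h3 := hwμ _ _ _ (right_ne_zero_of_mul h2)
    have h4 := hp2 _ _ (left_ne_zero_of_mul (left_ne_zero_of_mul h2))
    have h5 := hp2 _ _ (right_ne_zero_of_mul (left_ne_zero_of_mul h2))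
    linarith
  have hnn (a b k : Fin n) : 0 ≤ (d k - d a - d b) * ν (stdb n a) (stdb n b) k ^ 2 := by
    by_cases h : ν (stdb n a) (stdb n b) k = 0
    · simp [h]
    · exact mul_nonneg (by linarith [hwν a b k h]) (sq_nonneg _)
  set W := ∑ i, ∑ j, ∑ k, (d k - d i - d j) * ν (stdb n i) (stdb n j) k ^ 2
  have hW0 : 0 ≤ W := Finset.sum_nonneg fun i _ => Finset.sum_nonneg fun j _ =>
    Finset.sum_nonneg fun k _ => hnn i j k
  have hμd : ∑ i, d i * Ric μ i i = 0 := by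
    rw [sum_mul_Ric_diag hμ]
    refine mul_eq_zero_of_right _ (Finset.sum_eq_zero fun i _ => Finset.sum_eq_zero fun j _ =>
      Finset.sum_eq_zero fun k _ => ?_)
    by_cases h : μ (stdb n i) (stdb n j) k = 0
    · simp [h]
    · rw [hwμ i j k h]; ring
  have hfrob : frobSq (Ric μ) = ∑ i, (c + d i) * Ric μ i i := by
    conv_lhs => rw [hR]
    simp [frobSq, hRii, Matrix.trace, Matrix.diagonal_mul_diagonal]
  have hinner : ∑ i, (c + d i) * Ric ν i i = frobSq (Ric μ) + 1 / 4 * W := by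
    rw [hfrob]
    simp only [add_mul, Finset.sum_add_distrib, ← Finset.mul_sum]
    rw [hμd, sum_Ric_diag hμ, sum_Ric_diag hν, sum_mul_Ric_diag hν, hN]
    ring
  have hdist : frobSq (Ric ν - Ric μ) = frobSq (Ric ν) - frobSq (Ric μ) - 1 / 2 * W := by
    have := frobSq_sub_diagonal (Ric ν) fun i => c + d i
    rw [← hR, hinner] at this
    rw [this]
    ring
  have hdist0 := frobSq_nonneg (Ric ν - Ric μ)
  refine ⟨by linarith, fun heq => ?_⟩
  have hWz : W = 0 := by linarith
  have hRicEq : Ric ν = Ric μ := sub_eq_zero.1 (eq_zero_of_frobSq_eq_zero (by linarith))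
  have hwν' (a b k : Fin n) (h : ν (stdb n a) (stdb n b) k ≠ 0) : d k = d a + d b := by
    have a1 := (Finset.sum_eq_zero_iff_of_nonneg fun i _ => Finset.sum_nonneg fun j _ =>
      Finset.sum_nonneg fun k _ => hnn i j k).1 hWz a (Finset.mem_univ _)
    have a2 := (Finset.sum_eq_zero_iff_of_nonneg fun j _ =>
      Finset.sum_nonneg fun k _ => hnn a j k).1 a1 b (Finset.mem_univ _)
    have a3 := (Finset.sum_eq_zero_iff_of_nonneg fun k _ => hnn a b k).1 a2 k (Finset.mem_univ _)
    have := (mul_eq_zero.1 a3).resolve_right (pow_ne_zero 2 h)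
    linarith
  let lev (M : Matrix (Fin n) (Fin n) ℝ) : Matrix (Fin n) (Fin n) ℝ :=
    Matrix.of fun i j => if d i = d j then M i j else 0
  have hlev (M N : Matrix (Fin n) (Fin n) ℝ) (hM : ∀ i j, M i j ≠ 0 → d j ≤ d i)
      (hN : ∀ i j, N i j ≠ 0 → d j ≤ d i) (hMN : M * N = 1) : lev M * lev N = 1 := by
    rw [← hMN]
    ext i j
    by_cases hij : d i = d j
    · rw [Matrix.mul_apply, Matrix.mul_apply]
      refine Finset.sum_congr rfl fun l _ => ?_
      by_cases h : M i l * N l j = 0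
      · rw [h]
        by_cases h1 : d i = d l <;> by_cases h2 : d l = d j <;> simp [lev, h1, h2, h]
      · have h1 := hM _ _ (left_ne_zero_of_mul h)
        have h2 := hN _ _ (right_ne_zero_of_mul h)
        have h3 : d i = d l := by linarith
        have h4 : d l = d j := by linarith
        simp [lev, h3, h4]
    · have : (M * N) i j = 0 := by
        rw [hMN, Matrix.one_apply_ne]
        rintro rfl
        exact hij rfl
      rw [this, Matrix.mul_apply]
      refine Finset.sum_eq_zero fun l _ => ?_
      by_cases h1 : d i = d l
      · have h2 : d l ≠ d j := h1 ▸ hij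
        simp [lev, h2]
      · simp [lev, h1]
  let q : GL (Fin n) ℝ := ⟨lev p.1, lev p⁻¹.1, hlev _ _ hp1 hp2 (by simp),
    hlev _ _ hp2 hp1 (by simp)⟩
  have hq (i j) : q.1 i j = if d i = d j then p.1 i j else 0 := rfl
  have hνq : ν = act q μ := by
    refine eq_act_of_forall_stdb hμ hν q fun i j => funext fun k => ?_
    have hpν := congrFun (mulVec_apply_eq_act p μ (stdb n i) (stdb n j)) k
    rw [← hνdef, hν.apply_eq_sum] at hpν
    rw [hν.apply_eq_sum]
    simp only [mulVec_stdb, Finset.sum_apply, Pi.smul_apply, smul_eq_mul] at hpν ⊢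
    simp only [Matrix.mulVec, dotProduct] at hpν ⊢
    by_cases hk : d k = d i + d j
    · have e1 : ∑ x, q.1 k x * μ (stdb n i) (stdb n j) x =
          ∑ x, p.1 k x * μ (stdb n i) (stdb n j) x := by
        refine Finset.sum_congr rfl fun l _ => ?_
        by_cases h : μ (stdb n i) (stdb n j) l = 0
        · simp [h]
        · rw [hq, if_pos (by rw [hk, hwμ _ _ _ h])]
      rw [e1, hpν]
      refine Finset.sum_congr rfl fun a _ => Finset.sum_congr rfl fun b _ => ?_
      by_cases h : p.1 a i * p.1 b j * ν (stdb n a) (stdb n b) k = 0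
      · rw [h, hq, hq]
        split_ifs <;> simp [h]
      · have h1 := hp1 _ _ (left_ne_zero_of_mul (left_ne_zero_of_mul h))
        have h2 := hp1 _ _ (right_ne_zero_of_mul (left_ne_zero_of_mul h))
        have h3 := hwν' _ _ _ (right_ne_zero_of_mul h)
        rw [hq, hq, if_pos (by linarith), if_pos (by linarith)]
    · trans 0
      · refine Finset.sum_eq_zero fun l _ => ?_
        by_cases h : μ (stdb n i) (stdb n j) l = 0
        · simp [h]
        · rw [hq, if_neg (by rwa [hwμ _ _ _ h]), zero_mul]
      · refine (Finset.sum_eq_zero fun a _ => Finset.sum_eq_zero fun b _ => ?_).symm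
        by_contra h
        have h1 := left_ne_zero_of_mul (left_ne_zero_of_mul h)
        have h2 := right_ne_zero_of_mul (left_ne_zero_of_mul h)
        have h3 := hwν' _ _ _ (right_ne_zero_of_mul h)
        rw [hq] at h1 h2
        have h1' := (ite_ne_right_iff.1 h1).1
        have h2' := (ite_ne_right_iff.1 h2).1
        exact hk (by rw [h3, h1', h2'])
  have hcomm : q.1 * Ric μ = Ric μ * q.1 := by
    ext i j
    rw [hR, Matrix.mul_diagonal, Matrix.diagonal_mul, hq]
    split_ifs with h
    · rw [h, mul_comm]
    · simp
  rw [hνq]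
  exact exists_orthogonal_of_commute_Ric hμ q hcomm (hνq ▸ hRicEq)

theorem frobSq_Ric_le_of_minimal (hμ : IsSkewBilin μ) {c : ℝ} {D : Matrix (Fin n) (Fin n) ℝ}
    (hRic : Ric μ = c • (1 : Matrix (Fin n) (Fin n) ℝ) + D) (hD : IsDeriv μ D)
    (g : GL (Fin n) ℝ) (hN : normSq (act g μ) = normSq μ) :
    frobSq (Ric μ) ≤ frobSq (Ric (act g μ)) ∧
      (frobSq (Ric (act g μ)) = frobSq (Ric μ) →
        ∃ k : GL (Fin n) ℝ, k.1ᵀ * k.1 = 1 ∧ act g μ = act k μ) := by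
  have hDs : D.IsHermitian := by
    rw [← sub_eq_iff_eq_add'.2 hRic]
    exact (Ric_isHermitian μ).sub (by simp [Matrix.IsHermitian])
  obtain ⟨u, d, hu, hd⟩ := exists_orthogonal_diagonalization hDs
  obtain ⟨k, hk, htri⟩ := exists_orthogonal_mul_blockTriangular (g * u⁻¹) fun i => -d i
  have hact : act (k * (g * u⁻¹)) (act u μ) = act k (act g μ) := by
    rw [← act_mul, ← act_mul]
    congr 1
    group
  have hD' : IsDeriv (act u μ) (Matrix.diagonal d) := by
    have := hD.act u
    rwa [inv_eq_transpose hu, hd] at this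
  have hRic' : Ric (act u μ) = c • (1 : Matrix (Fin n) (Fin n) ℝ) + Matrix.diagonal d := by
    rw [Ric_act_orthogonal hμ hu, hRic, ← hd, Matrix.mul_add, Matrix.add_mul, Matrix.mul_smul,
      Matrix.smul_mul, Matrix.mul_one, mul_eq_one_comm.1 hu]
  have key := minimal_diagonal_case (hμ.act u) hRic' hD' (k * (g * u⁻¹)) htri
    (by rw [hact, normSq_act_orthogonal (hμ.act g) hk, normSq_act_orthogonal hμ hu, hN])
  rw [hact, Ric_act_orthogonal (hμ.act g) hk, Ric_act_orthogonal hμ hu, frobSq_orthogonal_conj hk,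
    frobSq_orthogonal_conj hu] at key
  refine ⟨key.1, fun heq => ?_⟩
  obtain ⟨l, hl, hlact⟩ := key.2 heq
  refine ⟨k⁻¹ * (l * u), orthogonal_mul (orthogonal_inv hk) (orthogonal_mul hl hu), ?_⟩
  rw [act_mul, act_mul, ← hlact, ← act_mul k⁻¹, inv_mul_cancel, act_one]

theorem normSq_pos (hμ : IsSkewBilin μ) (hne : μ ≠ 0) : 0 < normSq μ := by
  have hnn (i j k : Fin n) : 0 ≤ μ (stdb n i) (stdb n j) k ^ 2 := sq_nonneg _
  have h0 : 0 ≤ normSq μ := Finset.sum_nonneg fun i _ => Finset.sum_nonneg fun j _ =>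
    Finset.sum_nonneg fun k _ => hnn i j k
  refine h0.lt_of_ne' fun h => hne ?_
  refine hμ.ext_stdb ⟨by simp, by simp, by simp⟩ fun a b => funext fun k => ?_
  have a1 := (Finset.sum_eq_zero_iff_of_nonneg fun i _ => Finset.sum_nonneg fun j _ =>
    Finset.sum_nonneg fun k _ => hnn i j k).1 h a (Finset.mem_univ _)
  have a2 := (Finset.sum_eq_zero_iff_of_nonneg fun j _ =>
    Finset.sum_nonneg fun k _ => hnn a j k).1 a1 b (Finset.mem_univ _)
  have a3 := (Finset.sum_eq_zero_iff_of_nonneg fun k _ => hnn a b k).1 a2 k (Finset.mem_univ _)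
  simpa using a3

theorem Ric_smul (t : ℝ) (μ : Vm n) : Ric (t • μ) = t ^ 2 • Ric μ := by
  ext x y
  simp only [Ric, Matrix.of_apply, Matrix.smul_apply, Pi.smul_apply, smul_eq_mul, Finset.mul_sum,
    mul_add]
  congr 1 <;>
  exact Finset.sum_congr rfl fun i _ => Finset.sum_congr rfl fun j _ => by ring

theorem normSq_smul (t : ℝ) (μ : Vm n) : normSq (t • μ) = t ^ 2 * normSq μ := by
  simp only [normSq, Pi.smul_apply, smul_eq_mul, Finset.mul_sum, mul_pow]

theorem IsDeriv.smul {D : Matrix (Fin n) (Fin n) ℝ} (h : IsDeriv μ D) (s t : ℝ)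
    (hμ : IsSkewBilin μ) : IsDeriv (t • μ) (s • D) := by
  intro X Y
  simp only [Pi.smul_apply, Matrix.smul_mulVec, Matrix.mulVec_smul, h X Y, hμ.smul_left, hμ.smul_right,
    smul_add]

theorem exists_act_eq_inv_smul_act (hμ : IsSkewBilin μ) (g : GL (Fin n) ℝ) {s : ℝ} (hs : s ≠ 0) :
    ∃ h : GL (Fin n) ℝ, act h μ = s⁻¹ • act g μ := by
  let z : GL (Fin n) ℝ := ⟨s • 1, s⁻¹ • 1, by simp [hs], by simp [hs]⟩
  refine ⟨z * g, ?_⟩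
  rw [act_mul]
  refine (eq_act_of_forall_stdb (hμ.act g) ?_ z fun i j => ?_).symm
  · obtain ⟨h1, h2, h3⟩ := hμ.act g
    refine ⟨fun c X X' Y => ?_, fun c X Y Y' => ?_, fun X Y => ?_⟩
    · simp only [Pi.smul_apply, h1, smul_add, smul_comm c s⁻¹]
    · simp only [Pi.smul_apply, h2, smul_add, smul_comm c s⁻¹]
    · simp only [Pi.smul_apply]
      rw [h3, smul_neg]
  · have hz (X) : z.1.mulVec X = s • X := by
      change (s • (1 : Matrix (Fin n) (Fin n) ℝ)).mulVec X = _
      simp [Matrix.smul_mulVec]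
    simp only [hz, Pi.smul_apply, (hμ.act g).smul_left, (hμ.act g).smul_right, smul_smul]
    congr 1
    field_simp

end Brackets

/-- uniqueness up to scaling and orthogonal conjugation of minimal metrics:
if both `μ` and `g·μ` satisfy `Ric = cI + D` (with `D` a derivation), then
`g·μ = r (k·μ)` for some `r ≠ 0` and orthogonal `k`. -/
theorem minimal_unique_up_to_isometry_and_scaling (n : ℕ) (μ : Vm n)
    (hskew : IsSkewBilin μ) (hjac : Jacobi μ) (hnil : IsNilp μ) (hne : μ ≠ 0)
    (c : ℝ) (D : Matrix (Fin n) (Fin n) ℝ)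
    (hRic : Ric μ = c • (1 : Matrix (Fin n) (Fin n) ℝ) + D) (hD : IsDeriv μ D)
    (g : GL (Fin n) ℝ) (c' : ℝ) (D' : Matrix (Fin n) (Fin n) ℝ)
    (hRic' : Ric (act g μ) = c' • (1 : Matrix (Fin n) (Fin n) ℝ) + D')
    (hD' : IsDeriv (act g μ) D') :
    ∃ (r : ℝ) (k : GL (Fin n) ℝ), r ≠ 0 ∧
      ((k : Matrix (Fin n) (Fin n) ℝ))ᵀ * (k : Matrix (Fin n) (Fin n) ℝ) = 1 ∧
      act g μ = r • act k μ := by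
  have hνs := hskew.act g
  have hνne : act g μ ≠ 0 := by
    intro h
    apply hne
    rw [← act_one μ, ← inv_mul_cancel g, act_mul, h]
    funext X Y
    simp [act]
  have hN := normSq_pos hskew hne
  have hN' := normSq_pos hνs hνne
  let s := √(normSq (act g μ) / normSq μ)
  have hs : 0 < s := Real.sqrt_pos.2 (div_pos hN' hN)
  have hs2 : s ^ 2 = normSq (act g μ) / normSq μ := Real.sq_sqrt (div_pos hN' hN).le
  obtain ⟨h, hh⟩ := exists_act_eq_inv_smul_act hskew g hs.ne'
  have hnorm : normSq (act h μ) = normSq μ := by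
    rw [hh, normSq_smul, inv_pow, hs2]
    field_simp
  have hback : act h⁻¹ (act h μ) = μ := by
    rw [← act_mul, inv_mul_cancel, act_one]
  have hRich : Ric (act h μ) = (s⁻¹ ^ 2 * c') • (1 : Matrix (Fin n) (Fin n) ℝ) +
      s⁻¹ ^ 2 • D' := by
    rw [hh, Ric_smul, hRic', smul_add, smul_smul]
  have hDh : IsDeriv (act h μ) (s⁻¹ ^ 2 • D') := hh ▸ hD'.smul _ _ hνs
  have h1 := frobSq_Ric_le_of_minimal hskew hRic hD h hnorm
  have h2 := frobSq_Ric_le_of_minimal (hskew.act h) hRich hDh h⁻¹ (by rw [hback, hnorm])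
  rw [hback] at h2
  obtain ⟨k, hk, hkact⟩ := h1.2 (le_antisymm h2.1 h1.1)
  refine ⟨s, k, hs.ne', hk, ?_⟩
  rw [← hkact, hh, smul_smul, mul_inv_cancel₀ hs.ne', one_smul]
end
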